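/- Let f : {0,1}^n → {0,1} be a non-constant Boolean function, let k_1 be the largest size of a prime implicant of f and k_2 the largest size of a prime implicate of f. Then s_u^{(1)}(f̃) = k_1, s_u^{(0)}(f̃) = k_2, and s_u^{(u)}(f̃) ≤ k_1 + k_2 − 1. -/

import Mathlib

/-- Kleene's three-valued domain: `none` is the unstable value `u`,
`some b` is a stable Boolean value. -/
abbrev K : Type := Option Bool

namespace HF

variable {ι : Type} [Fintype ι] [DecidableEq ι]

/-- Instability order on inputs: `Below x y` means `x ≤ y`, i.e. each coordinate of `x`
is either `u` or equal to the corresponding coordinate of `y`. -/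
def Below (x y : ι → K) : Prop := ∀ i, x i = none ∨ x i = y i

/-- `x` is strictly below `y` in the instability order. -/
def StrictBelow (x y : ι → K) : Prop := Below x y ∧ x ≠ y

/-- `y` is strictly above `x` in the instability order. -/
def StrictAbove (y x : ι → K) : Prop := Below x y ∧ y ≠ x

/-- `x : ι → Bool` is a resolution of `y : ι → K`. -/
def Resolves (y : ι → K) (x : ι → Bool) : Prop := ∀ i, y i = none ∨ y i = some (x i)

instance (y : ι → K) : DecidablePred (Resolves y) := fun x => by
  unfold Resolves; infer_instance

/-- The hazard-free extension of a Boolean function `f`. -/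
def hfExt (f : (ι → Bool) → Bool) (y : ι → K) : K :=
  if ∀ x, Resolves y x → f x = true then some true
  else if ∀ x, Resolves y x → f x = false then some false
  else none

/-- Number of unstable (`u`) coordinates of an input. -/
def numU (x : ι → K) : ℕ := (Finset.univ.filter fun i => x i = none).card

/-- Ternary (hazard-free) decision trees: leaves are labeled by values in `K`,
internal nodes query a position and have children for responses `0`, `u`, `1`. -/
inductive TDT (ι : Type) : Type where
  | leaf : K → TDT ι
  | node : ι → TDT ι → TDT ι → TDT ι → TDT ι

namespace TDT

/-- Evaluate a ternary decision tree on an input in `K^ι`. -/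
def eval : TDT ι → (ι → K) → K
  | .leaf b, _ => b
  | .node i t0 tu t1, x =>
    match x i with
    | some false => eval t0 x
    | none => eval tu x
    | some true => eval t1 x

/-- Depth of a ternary decision tree. -/
def depth : TDT ι → ℕ
  | .leaf _ => 0
  | .node _ t0 tu t1 => max (max (depth t0) (depth tu)) (depth t1) + 1

/-- Size (number of leaves) of a ternary decision tree. -/
def size : TDT ι → ℕ
  | .leaf _ => 1
  | .node _ t0 tu t1 => size t0 + size tu + size t1

end TDT

/-- Boolean decision trees. -/
inductive BDT (ι : Type) : Type where
  | leaf : Bool → BDT ι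
  | node : ι → BDT ι → BDT ι → BDT ι

namespace BDT

/-- Evaluate a Boolean decision tree. -/
def eval : BDT ι → (ι → Bool) → Bool
  | .leaf b, _ => b
  | .node i t0 t1, x => if x i then eval t1 x else eval t0 x

/-- Depth of a Boolean decision tree. -/
def depth : BDT ι → ℕ
  | .leaf _ => 0
  | .node _ t0 t1 => max (depth t0) (depth t1) + 1

/-- Size (number of leaves) of a Boolean decision tree. -/
def size : BDT ι → ℕ
  | .leaf _ => 1
  | .node _ t0 t1 => size t0 + size t1

end BDT

/-- A ternary tree computes (the hazard-free extension of) the Boolean function `f`. -/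
def ComputesHF (f : (ι → Bool) → Bool) (T : TDT ι) : Prop := ∀ x, T.eval x = hfExt f x

/-- A ternary tree computes a `K`-valued function `g`. -/
def ComputesT (g : (ι → K) → K) (T : TDT ι) : Prop := ∀ x, T.eval x = g x

/-- A Boolean tree computes the Boolean function `f`. -/
def ComputesB (f : (ι → Bool) → Bool) (T : BDT ι) : Prop := ∀ x, T.eval x = f x

/-- A `k`-bit hazard-free decision tree for `f`: correct on all inputs with at most
`k` unstable coordinates. -/
def KComputes (k : ℕ) (f : (ι → Bool) → Bool) (T : TDT ι) : Prop :=
  ∀ x : ι → K, numU x ≤ k → T.eval x = hfExt f x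

/-- Minimum depth of a ternary decision tree computing a `K`-valued function. -/
noncomputable def depthT (g : (ι → K) → K) : ℕ :=
  sInf {d | ∃ T : TDT ι, ComputesT g T ∧ T.depth = d}

/-- Hazard-free decision tree depth of a Boolean function. -/
noncomputable def depthU (f : (ι → Bool) → Bool) : ℕ :=
  sInf {d | ∃ T : TDT ι, ComputesHF f T ∧ T.depth = d}

/-- Hazard-free decision tree size (minimum number of leaves). -/
noncomputable def sizeU (f : (ι → Bool) → Bool) : ℕ :=
  sInf {s | ∃ T : TDT ι, ComputesHF f T ∧ T.size = s}

/-- Boolean decision tree size (minimum number of leaves). -/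
noncomputable def sizeB (f : (ι → Bool) → Bool) : ℕ :=
  sInf {s | ∃ T : BDT ι, ComputesB f T ∧ T.size = s}

/-- The multiplexer function `MUX n` on `n` selector bits and `2^n` data bits. -/
def MUX (n : ℕ) (z : (Fin n ⊕ (Fin n → Bool)) → Bool) : Bool :=
  z (Sum.inr fun i => z (Sum.inl i))

/-- Hazard-free sensitivity of `g` at `x`. -/
noncomputable def sensAt (g : (ι → K) → K) (x : ι → K) : ℕ :=
  Set.ncard {i : ι | ∃ y : ι → K, y i ≠ x i ∧ (∀ j, j ≠ i → y j = x j) ∧ g y ≠ g x}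

/-- Hazard-free sensitivity of `g`. -/
noncomputable def sens (g : (ι → K) → K) : ℕ := ⨆ x : ι → K, sensAt g x

/-- Hazard-free sensitivity of `g` restricted to inputs with output value `b`. -/
noncomputable def sensVal (g : (ι → K) → K) (b : K) : ℕ :=
  ⨆ x : {x : ι → K // g x = b}, sensAt g x.1

/-- Hazard-free block sensitivity of `g` at `x`. -/
noncomputable def bsensAt (g : (ι → K) → K) (x : ι → K) : ℕ :=
  sSup {k : ℕ | ∃ B : Fin k → Finset ι, (∀ j, (B j).Nonempty) ∧
    (∀ j j', j ≠ j' → Disjoint (B j) (B j')) ∧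
    ∀ j, ∃ y : ι → K, (∀ i, y i ≠ x i ↔ i ∈ B j) ∧ g y ≠ g x}

/-- Hazard-free block sensitivity of `g`. -/
noncomputable def bsens (g : (ι → K) → K) : ℕ := ⨆ x, bsensAt g x

/-- Hazard-free certificate complexity of `g` at `x`. -/
noncomputable def ccAt (g : (ι → K) → K) (x : ι → K) : ℕ :=
  sInf {k : ℕ | ∃ S : Finset ι, S.card = k ∧
    ∀ y : ι → K, (∀ i ∈ S, y i = x i) → g y = g x}

/-- Hazard-free certificate complexity of `g`. -/
noncomputable def cc (g : (ι → K) → K) : ℕ := ⨆ x, ccAt g x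

/-- Hazard-free certificate complexity of `g` restricted to inputs with output value `b`. -/
noncomputable def ccVal (g : (ι → K) → K) (b : K) : ℕ :=
  ⨆ x : {x : ι → K // g x = b}, ccAt g x.1

/-- Boolean sensitivity of a Boolean function. -/
noncomputable def boolSens (f : (ι → Bool) → Bool) : ℕ :=
  ⨆ x : ι → Bool, Set.ncard {i : ι | f (Function.update x i (!(x i))) ≠ f x}

/-- `p` is a prime implicant of `f`. -/
def PrimeImplicant (f : (ι → Bool) → Bool) (p : ι → K) : Prop :=
  hfExt f p = some true ∧ ∀ q, StrictBelow q p → hfExt f q ≠ some true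

/-- `p` is a prime implicate of `f`. -/
def PrimeImplicate (f : (ι → Bool) → Bool) (p : ι → K) : Prop :=
  hfExt f p = some false ∧ ∀ q, StrictBelow q p → hfExt f q ≠ some false

/-- Size of an implicant/implicate: the number of stable coordinates. -/
noncomputable def isize (p : ι → K) : ℕ := Set.ncard {i : ι | p i ≠ none}

/-- Hamming distance between two inputs in `K^ι`. -/
noncomputable def hamm (x y : ι → K) : ℕ := Set.ncard {i : ι | x i ≠ y i}

/-- Hazard-free evaluation of a literal (variable and polarity). -/
def litEval (x : ι → K) (l : ι × Bool) : K := if l.2 then x l.1 else (x l.1).map not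

/-- Hazard-free evaluation of a term (conjunction of literals). -/
def termEval (t : Finset (ι × Bool)) (x : ι → K) : K :=
  if ∀ l ∈ t, litEval x l = some true then some true
  else if ∃ l ∈ t, litEval x l = some false then some false
  else none

/-- Hazard-free evaluation of a clause (disjunction of literals). -/
def clauseEval (c : Finset (ι × Bool)) (x : ι → K) : K :=
  if ∃ l ∈ c, litEval x l = some true then some true
  else if ∀ l ∈ c, litEval x l = some false then some false
  else none

/-- Hazard-free evaluation of a DNF formula (a set of terms). -/
def dnfEval (D : Finset (Finset (ι × Bool))) (x : ι → K) : K :=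
  if ∃ t ∈ D, termEval t x = some true then some true
  else if ∀ t ∈ D, termEval t x = some false then some false
  else none

/-- Hazard-free evaluation of a CNF formula (a set of clauses). -/
def cnfEval (C : Finset (Finset (ι × Bool))) (x : ι → K) : K :=
  if ∀ c ∈ C, clauseEval c x = some true then some true
  else if ∃ c ∈ C, clauseEval c x = some false then some false
  else none

/-- A function `g : K^ι → K` is weakly hazard-free: it is monotone with respect to the
instability order, and whenever all points strictly above `x` have the same value `b`
(and some such point exists), `g x = b` as well. -/
def WeaklyHF (g : (ι → K) → K) : Prop :=
  (∀ x y, Below x y → g x = none ∨ g x = g y) ∧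
  (∀ x (b : K), (∃ y, StrictAbove y x) → (∀ y, StrictAbove y x → g y = b) → g x = b)

/-- The subcube `C(x)` is monochromatic for `f`. -/
def Mono (f : (ι → Bool) → Bool) (x : ι → K) : Prop :=
  ∀ y z : ι → Bool, Resolves x y → Resolves x z → f y = f z

/-- The subcube `C(x)` is colorful for `f` (contains both a 0-point and a 1-point). -/
def Colorful (f : (ι → Bool) → Bool) (x : ι → K) : Prop :=
  ∃ y z : ι → Bool, Resolves x y ∧ Resolves x z ∧ f y ≠ f z

/-- `C(x)` is a minimal colorful cube for `f`. -/
def MinColorful (f : (ι → Bool) → Bool) (x : ι → K) : Prop :=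
  Colorful f x ∧ ∀ i, x i = none →
    (Mono f (Function.update x i (some false)) ∨ Mono f (Function.update x i (some true)))

/-- A Boolean function is non-degenerate if it depends on every input position. -/
def Nondegenerate (f : (ι → Bool) → Bool) : Prop :=
  ∀ i : ι, ∃ x y : ι → Bool, (∀ j, j ≠ i → x j = y j) ∧ x i ≠ y i ∧ f x ≠ f y

/-- The `n`-input AND function. -/
def ANDf (n : ℕ) (x : Fin n → Bool) : Bool := decide (∀ i, x i = true)

set_option linter.unusedSectionVars false in
theorem exists_resolves (y : ι → K) : ∃ x, Resolves y x :=
  ⟨fun i => (y i).getD false, fun i => by cases h : y i <;> simp [h]⟩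

theorem hfExt_eq_some_iff (f : (ι → Bool) → Bool) (y : ι → K) (c : Bool) :
    hfExt f y = some c ↔ ∀ x, Resolves y x → f x = c := by
  obtain ⟨z, hz⟩ := exists_resolves y
  unfold hfExt
  split_ifs with ht hf
  · refine ⟨fun h x hx => ?_, fun h => ?_⟩
    · rw [ht x hx]; exact Option.some.inj h
    · rw [← ht z hz, h z hz]
  · refine ⟨fun h x hx => ?_, fun h => ?_⟩
    · rw [hf x hx]; exact Option.some.inj h
    · rw [← hf z hz, h z hz]
  · refine ⟨fun h => (nomatch h), fun h => ?_⟩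
    cases c
    · exact absurd h hf
    · exact absurd h ht

theorem hfExt_eq_some_of_below {f : (ι → Bool) → Bool} {p y : ι → K} {c : Bool}
    (hpy : Below p y) (hp : hfExt f p = some c) : hfExt f y = some c := by
  rw [hfExt_eq_some_iff] at hp ⊢
  refine fun x hx => hp x fun i => ?_
  rcases hpy i with h | h
  · exact Or.inl h
  · rw [h]; exact hx i

set_option linter.unusedSectionVars false in
theorem isize_lt_of_strictBelow {q p : ι → K} (h : StrictBelow q p) : isize q < isize p := by
  obtain ⟨hle, hne⟩ := h
  obtain ⟨i, hi⟩ := Function.ne_iff.mp hne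
  have hqi : q i = none := (hle i).resolve_right hi
  refine Set.ncard_lt_ncard (Set.ssubset_iff_of_subset ?_ |>.mpr ⟨i, ?_, ?_⟩) (Set.toFinite _)
  · intro j hj
    have hj' : q j ≠ none := hj
    have h := (hle j).resolve_left hj'
    show p j ≠ none
    rwa [← h]
  · show p i ≠ none
    rw [← hqi]; exact hi.symm
  · simpa using hqi

/-- Every point of value `c` lies above a minimal point of value `c`. -/
theorem exists_minimal_below {f : (ι → Bool) → Bool} {x : ι → K} {c : Bool}
    (hx : hfExt f x = some c) :
    ∃ p, Below p x ∧ hfExt f p = some c ∧ ∀ q, StrictBelow q p → hfExt f q ≠ some c := by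
  obtain ⟨p, ⟨hpx, hp⟩, hmin⟩ := Set.exists_min_image
    {p : ι → K | Below p x ∧ hfExt f p = some c} isize (Set.toFinite _)
    ⟨x, fun _ => Or.inr rfl, hx⟩
  refine ⟨p, hpx, hp, fun q hq hqc => ?_⟩
  refine (isize_lt_of_strictBelow hq).not_ge (hmin q ⟨fun i => ?_, hqc⟩)
  rcases hq.1 i with h | h
  · exact Or.inl h
  · rw [h]; exact hpx i

theorem sensAt_le_isize_of_below {f : (ι → Bool) → Bool} {p x : ι → K} {c : Bool}
    (hpx : Below p x) (hp : hfExt f p = some c) : sensAt (hfExt f) x ≤ isize p := by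
  refine Set.ncard_le_ncard ?_ (Set.toFinite _)
  rintro i ⟨y, -, hy, hne⟩ hpi
  refine hne ?_
  rw [hfExt_eq_some_of_below hpx hp]
  refine hfExt_eq_some_of_below (fun j => ?_) hp
  by_cases hj : j = i
  · exact Or.inl (hj ▸ hpi)
  · rw [hy j hj]; exact hpx j

theorem isize_le_sensAt_of_minimal {f : (ι → Bool) → Bool} {p : ι → K} {c : Bool}
    (hp : hfExt f p = some c) (hmin : ∀ q, StrictBelow q p → hfExt f q ≠ some c) :
    isize p ≤ sensAt (hfExt f) p := by
  refine Set.ncard_le_ncard (fun i hi => ?_) (Set.toFinite _)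
  have hi' : p i ≠ none := hi
  refine ⟨Function.update p i none, by simpa using hi'.symm,
    fun j hj => Function.update_of_ne hj _ _, ?_⟩
  rw [hp]
  refine hmin _ ⟨fun j => ?_, fun h => hi' ?_⟩
  · by_cases hj : j = i
    · subst hj; simp
    · exact Or.inr (Function.update_of_ne hj _ _)
  · rw [← h]; simp

theorem sensVal_some_eq {f : (ι → Bool) → Bool} {c : Bool} {k : ℕ}
    (h : IsGreatest {s : ℕ | ∃ p : ι → K, (hfExt f p = some c ∧
      ∀ q, StrictBelow q p → hfExt f q ≠ some c) ∧ isize p = s} k) :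
    sensVal (hfExt f) (some c) = k := by
  apply le_antisymm
  · refine ciSup_le' fun x => ?_
    obtain ⟨p, hpx, hp, hmin⟩ := exists_minimal_below x.2
    exact (sensAt_le_isize_of_below hpx hp).trans (h.2 ⟨p, ⟨hp, hmin⟩, rfl⟩)
  · obtain ⟨p, ⟨hp, hmin⟩, rfl⟩ := h.1
    exact (isize_le_sensAt_of_minimal hp hmin).trans
      (le_ciSup (f := fun x : {x : ι → K // hfExt f x = some c} => sensAt (hfExt f) x.1)
        (Set.finite_range _).bddAbove ⟨p, hp⟩)

/-- If changing `x` at `i` gives value `c`, then `i` is a stable position of every point `q` of a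
different value that shares a resolution with `x`. -/
theorem ne_none_of_hfExt_ne {f : (ι → Bool) → Bool} {x y q : ι → K} {b : ι → Bool} {c d : Bool}
    {i : ι} (hcd : c ≠ d) (hyx : ∀ j, j ≠ i → y j = x j) (hy : hfExt f y = some c)
    (hxb : Resolves x b) (hqb : Resolves q b) (hq : hfExt f q = some d) : q i ≠ none := by
  intro hqi
  rw [hfExt_eq_some_iff] at hy hq
  refine hcd ((hy (Function.update b i ((y i).getD false)) fun j => ?_).symm.trans
    (hq _ fun j => ?_))
  · by_cases hj : j = i
    · subst hj
      cases h : y j <;> simp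
    · rw [hyx j hj, Function.update_of_ne hj]; exact hxb j
  · by_cases hj : j = i
    · exact Or.inl (hj ▸ hqi)
    · rw [Function.update_of_ne hj]; exact hqb j

/-- Two points of different stable values share a stable position. -/
theorem exists_common_stable {f : (ι → Bool) → Bool} {p q : ι → K} {c d : Bool} (hcd : c ≠ d)
    (hp : hfExt f p = some c) (hq : hfExt f q = some d) : ∃ i, p i ≠ none ∧ q i ≠ none := by
  by_contra! h
  obtain ⟨a, ha⟩ := exists_resolves p
  obtain ⟨b, hb⟩ := exists_resolves q
  rw [hfExt_eq_some_iff] at hp hq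
  refine hcd ((hp (fun i => if p i = none then b i else a i) fun i => ?_).symm.trans
    (hq _ fun i => ?_))
  · by_cases hi : p i = none
    · exact Or.inl hi
    · simpa [hi] using ha i
  · by_cases hi : p i = none
    · simpa [hi] using hb i
    · exact Or.inl (h i hi)

theorem exists_resolves_of_hfExt_eq_none {f : (ι → Bool) → Bool} {x : ι → K}
    (hx : hfExt f x = none) (c : Bool) : ∃ a, Resolves x a ∧ f a = c := by
  by_contra! h
  have : hfExt f x = some (!c) :=
    (hfExt_eq_some_iff f x _).mpr fun a ha => Bool.eq_not.mpr (h a ha)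
  rw [hx] at this
  cases this

theorem exists_minimal_resolves {f : (ι → Bool) → Bool} {a : ι → Bool} {c : Bool}
    (ha : f a = c) : ∃ p, Resolves p a ∧ hfExt f p = some c ∧
      ∀ q, StrictBelow q p → hfExt f q ≠ some c := by
  refine exists_minimal_below (x := fun i => some (a i))
    ((hfExt_eq_some_iff f _ _).mpr fun x hx => ?_)
  have : a = x := funext fun i => by simpa using hx i
  rw [← this, ha]

/-- `s_u^{(1)}(f̃) = k₁`, `s_u^{(0)}(f̃) = k₂`, and
`s_u^{(u)}(f̃) ≤ k₁ + k₂ − 1`, where `k₁` (resp. `k₂`) is the largest size of a prime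
implicant (resp. prime implicate) of `f`. -/
theorem sens_vs_prime_implicants (n : ℕ) (f : (Fin n → Bool) → Bool)
    (hnc : ∃ x y, f x ≠ f y) (k1 k2 : ℕ)
    (h1 : IsGreatest {s : ℕ | ∃ p : Fin n → K, PrimeImplicant f p ∧ isize p = s} k1)
    (h2 : IsGreatest {s : ℕ | ∃ p : Fin n → K, PrimeImplicate f p ∧ isize p = s} k2) :
    sensVal (hfExt f) (some true) = k1 ∧ sensVal (hfExt f) (some false) = k2 ∧
      sensVal (hfExt f) none ≤ k1 + k2 - 1 := by
  refine ⟨sensVal_some_eq h1, sensVal_some_eq h2, ciSup_le' fun ⟨x, hx⟩ => ?_⟩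
  obtain ⟨a, hxa, ha⟩ := exists_resolves_of_hfExt_eq_none hx true
  obtain ⟨b, hxb, hb⟩ := exists_resolves_of_hfExt_eq_none hx false
  obtain ⟨p, hpa, hp, hpmin⟩ := exists_minimal_resolves ha
  obtain ⟨q, hqb, hq, hqmin⟩ := exists_minimal_resolves hb
  have hp1 : isize p ≤ k1 := h1.2 ⟨p, ⟨hp, hpmin⟩, rfl⟩
  have hq2 : isize q ≤ k2 := h2.2 ⟨q, ⟨hq, hqmin⟩, rfl⟩
  have hsub : sensAt (hfExt f) x ≤ ({i | p i ≠ none} ∪ {i | q i ≠ none} : Set (Fin n)).ncard := by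
    refine Set.ncard_le_ncard ?_ (Set.toFinite _)
    rintro i ⟨y, -, hyx, hne⟩
    rw [hx] at hne
    obtain ⟨c, hc⟩ := Option.ne_none_iff_exists'.mp hne
    cases c
    · exact Or.inl (ne_none_of_hfExt_ne (by decide) hyx hc hxa hpa hp)
    · exact Or.inr (ne_none_of_hfExt_ne (by decide) hyx hc hxb hqb hq)
  have hinter : 0 < ({i | p i ≠ none} ∩ {i | q i ≠ none} : Set (Fin n)).ncard :=
    (Set.ncard_pos (Set.toFinite _)).mpr (exists_common_stable (by decide) hp hq)
  have hcard := Set.ncard_union_add_ncard_inter {i | p i ≠ none} {i | q i ≠ none}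
  change _ = isize p + isize q at hcard
  change sensAt (hfExt f) x ≤ _
  omega

end HF
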